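/- For every n ≥ 1 and every t₀ > 0, the Hankel determinant t ↦ D_n(t) has a derivative at t₀ satisfying 2 t₀ D_n'(t₀) = σ_n(t₀) D_n(t₀); equivalently, σ_n(t) = 2t (d/dt) ln D_n(t). -/

import Mathlib

open MeasureTheory Polynomial

/-- The singularly perturbed Gaussian weight `w(x,t) = exp(-x^2 - t/x^2)` for `x ≠ 0`,
extended by `0` at `x = 0`. -/
noncomputable def w (t x : ℝ) : ℝ := if x = 0 then 0 else Real.exp (-x ^ 2 - t / x ^ 2)

theorem w_nonneg (t x : ℝ) : 0 ≤ w t x := by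
  unfold w
  split_ifs
  · exact le_rfl
  · exact (Real.exp_pos _).le

theorem measurable_w (t : ℝ) : Measurable (w t) := by
  unfold w
  exact Measurable.ite (measurableSet_singleton 0) measurable_const (by fun_prop)

theorem w_le_exp_neg_sq {t : ℝ} (ht : 0 < t) (x : ℝ) : w t x ≤ Real.exp (-x ^ 2) := by
  unfold w
  split_ifs
  · exact (Real.exp_pos _).le
  · exact Real.exp_le_exp.2 (sub_le_self _ (by positivity))

/-- Dividing the weight by `x ^ 2` keeps it under a Gaussian, uniformly for `t ≥ a`. -/
theorem inv_sq_mul_w_le {a t : ℝ} (ha : 0 < a) (hat : a ≤ t) (x : ℝ) :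
    (x ^ 2)⁻¹ * w t x ≤ a⁻¹ * Real.exp (-x ^ 2) := by
  unfold w
  split_ifs with hx
  · rw [mul_zero]; positivity
  · have hx2 : 0 < x ^ 2 := by positivity
    rw [sub_eq_add_neg, Real.exp_add, mul_left_comm, mul_comm]
    refine mul_le_mul_of_nonneg_right ?_ (Real.exp_pos _).le
    have h1 : a / x ^ 2 ≤ Real.exp (t / x ^ 2) := by
      have := Real.add_one_le_exp (t / x ^ 2)
      have : a / x ^ 2 ≤ t / x ^ 2 := by gcongr
      linarith
    rw [Real.exp_neg, ← mul_inv]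
    apply inv_anti₀ ha
    rwa [div_le_iff₀' hx2] at h1

theorem integrable_eval_mul_exp_neg_sq (q : ℝ[X]) :
    Integrable fun x : ℝ => q.eval x * Real.exp (-x ^ 2) := by
  induction q using Polynomial.induction_on' with
  | add p q hp hq =>
    simp only [eval_add, add_mul]
    exact hp.add hq
  | monomial k a =>
    have := (integrable_rpow_mul_exp_neg_mul_sq (b := 1) one_pos (s := k)
      (by have : (0 : ℝ) ≤ k := k.cast_nonneg
          linarith)).const_mul a
    simpa [mul_assoc] using this

theorem integrable_eval_mul_w (q : ℝ[X]) {t : ℝ} (ht : 0 < t) :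
    Integrable fun x : ℝ => q.eval x * w t x := by
  refine (integrable_eval_mul_exp_neg_sq q).mono
    (q.continuous.measurable.mul (measurable_w t)).aestronglyMeasurable (ae_of_all _ fun x => ?_)
  rw [norm_mul, norm_mul, Real.norm_of_nonneg (w_nonneg t x),
    Real.norm_of_nonneg (Real.exp_pos _).le]
  exact mul_le_mul_of_nonneg_left (w_le_exp_neg_sq ht x) (norm_nonneg _)

theorem hasDerivAt_w (t x : ℝ) :
    HasDerivAt (fun s => w s x) (-((x ^ 2)⁻¹ * w t x)) t := by
  unfold w
  split_ifs
  · simpa using hasDerivAt_const t (0 : ℝ)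
  · have := (((hasDerivAt_id t).div_const (x ^ 2)).const_sub (-x ^ 2)).exp
    refine this.congr_deriv ?_
    simp only [id]
    ring

theorem hasDerivAt_integral_eval_mul_w (q : ℝ[X]) {t : ℝ} (ht : 0 < t) :
    HasDerivAt (fun s => ∫ x : ℝ, q.eval x * w s x) (-∫ x : ℝ, q.eval x / x ^ 2 * w t x) t := by
  have hbound (x s : ℝ) (hs : s ∈ Set.Ioi (t / 2)) :
      ‖q.eval x * -((x ^ 2)⁻¹ * w s x)‖ ≤ (t / 2)⁻¹ * ‖q.eval x * Real.exp (-x ^ 2)‖ := by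
    rw [norm_mul, norm_mul, norm_neg, Real.norm_of_nonneg (Real.exp_pos _).le,
      Real.norm_of_nonneg (mul_nonneg (inv_nonneg.2 (sq_nonneg x)) (w_nonneg s x)),
      mul_left_comm (t / 2)⁻¹]
    exact mul_le_mul_of_nonneg_left (inv_sq_mul_w_le (half_pos ht) (le_of_lt hs) x)
      (norm_nonneg (q.eval x))
  have key := (hasDerivAt_integral_of_dominated_loc_of_deriv_le (μ := volume) (x₀ := t)
    (s := Set.Ioi (t / 2))
    (F := fun s x => q.eval x * w s x)
    (F' := fun s x => q.eval x * -((x ^ 2)⁻¹ * w s x))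
    (bound := fun x => (t / 2)⁻¹ * ‖q.eval x * Real.exp (-x ^ 2)‖)
    (Ioi_mem_nhds (by linarith))
    (.of_forall fun s => (q.continuous.measurable.mul (measurable_w s)).aestronglyMeasurable)
    (integrable_eval_mul_w q ht)
    (q.continuous.measurable.mul ((measurable_id.pow_const 2).inv.mul
      (measurable_w t)).neg).aestronglyMeasurable
    (ae_of_all _ hbound)
    ((integrable_eval_mul_exp_neg_sq q).norm.const_mul _)
    (ae_of_all _ fun x s _ => (hasDerivAt_w s x).const_mul _)).2
  refine key.congr_deriv ?_
  rw [← integral_neg]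
  congr 1 with x
  ring

/-- Jacobi's formula for the derivative of a determinant at a point where the matrix is
diagonal. -/
theorem HasDerivAt.det_of_eq_diagonal {ι : Type*} [Fintype ι] [DecidableEq ι]
    {M : ℝ → Matrix ι ι ℝ} {M' : Matrix ι ι ℝ} {d : ι → ℝ} {t : ℝ}
    (hM : ∀ i j, HasDerivAt (fun s => M s i j) (M' i j) t) (hd : M t = Matrix.diagonal d) :
    HasDerivAt (fun s => (M s).det) (∑ i, (∏ j ∈ Finset.univ.erase i, d j) * M' i i) t := by
  simp only [Matrix.det_apply']
  have key := HasDerivAt.fun_sum (u := Finset.univ) fun (τ : Equiv.Perm ι) _ =>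
    (HasDerivAt.fun_finsetProd (u := Finset.univ) fun i _ => hM (τ i) i).const_mul
      ((Equiv.Perm.sign τ : ℤ) : ℝ)
  refine key.congr_deriv ?_
  rw [Finset.sum_eq_single 1]
  · simp [hd]
  · intro τ _ hτ
    rw [Finset.sum_eq_zero, mul_zero]
    intro i _
    obtain ⟨j, hji, hj⟩ : ∃ j, j ≠ i ∧ τ j ≠ j := by
      by_contra! hfix
      refine hτ (Equiv.ext fun k => ?_)
      rcases eq_or_ne k i with rfl | hk
      · by_contra hne
        exact hne (τ.injective (hfix _ hne))
      · exact hfix k hk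
    rw [Finset.prod_eq_zero (i := j) (by simp [hji]) (by simp [hd, hj]), zero_smul]
  · simp

/-- A unitriangular change of basis does not change the Hankel determinant of the weight. -/
theorem det_moments_eq_det_integral_eval_mul (n : ℕ) (p : ℕ → ℝ[X])
    (hmonic : ∀ i, (p i).Monic) (hdeg : ∀ i, (p i).natDegree = i) {t : ℝ} (ht : 0 < t) :
    Matrix.det (Matrix.of fun i j : Fin n => ∫ x : ℝ, x ^ ((i : ℕ) + (j : ℕ)) * w t x) =
      Matrix.det (Matrix.of fun i j : Fin n => ∫ x : ℝ, (p i * p j).eval x * w t x) := by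
  set G := Matrix.of fun i j : Fin n => ∫ x : ℝ, x ^ ((i : ℕ) + (j : ℕ)) * w t x with hG
  let A : Matrix (Fin n) (Fin n) ℝ := Matrix.of fun i k => (p i).coeff k
  have hA : A.det = 1 := by
    rw [Matrix.det_of_isLowerTriangular]
    · exact Finset.prod_eq_one fun i _ => by
        simpa [A, Polynomial.Monic, leadingCoeff, hdeg] using hmonic i
    · intro i j hij
      exact coeff_eq_zero_of_natDegree_lt (by rw [hdeg]; exact hij)
  have hmul : Matrix.of (fun i j : Fin n => ∫ x : ℝ, (p i * p j).eval x * w t x) =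
      A * G * A.transpose := by
    ext i j
    have heval (i : Fin n) (x : ℝ) : (p i).eval x = ∑ k : Fin n, A i k * x ^ (k : ℕ) := by
      rw [eval_eq_sum_range' ((hdeg i).trans_lt i.2), Finset.sum_range]
      rfl
    have hint (k l : Fin n) :
        Integrable fun x : ℝ => A i k * (x ^ ((k : ℕ) + (l : ℕ)) * w t x) * A j l := by
      have := integrable_eval_mul_w (X ^ ((k : ℕ) + (l : ℕ))) ht
      simp only [eval_pow, eval_X] at this
      exact (this.const_mul _).mul_const _
    have hexp : (fun x : ℝ => (p i * p j).eval x * w t x) = fun x =>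
        ∑ l : Fin n, ∑ k : Fin n, A i k * (x ^ ((k : ℕ) + (l : ℕ)) * w t x) * A j l := by
      ext x
      rw [eval_mul, heval, heval, Finset.sum_mul_sum, Finset.sum_comm, Finset.sum_mul]
      refine Finset.sum_congr rfl fun l _ => ?_
      rw [Finset.sum_mul]
      exact Finset.sum_congr rfl fun k _ => by ring
    rw [Matrix.of_apply, hexp,
      integral_finsetSum _ fun l _ => integrable_finsetSum _ fun k _ => hint k l, Matrix.mul_apply]
    refine Finset.sum_congr rfl fun l _ => ?_
    rw [integral_finsetSum _ fun k _ => hint k l, Matrix.mul_apply, Finset.sum_mul]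
    refine Finset.sum_congr rfl fun k _ => ?_
    rw [integral_mul_const, integral_const_mul]
    rfl
  rw [hmul, Matrix.det_mul, Matrix.det_mul, Matrix.det_transpose, hA, one_mul, mul_one]

theorem statement12
    (P : ℕ → ℝ → Polynomial ℝ)
    (hmonic : ∀ n : ℕ, ∀ t : ℝ, 0 < t → (P n t).Monic)
    (hdeg : ∀ n : ℕ, ∀ t : ℝ, 0 < t → (P n t).natDegree = n)
    (horth : ∀ m n : ℕ, m ≠ n → ∀ t : ℝ, 0 < t →
      ∫ x : ℝ, (P m t).eval x * (P n t).eval x * w t x = 0)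
    (hcoeff : ∀ n k : ℕ, ∀ t : ℝ, 0 < t →
      DifferentiableAt ℝ (fun s => (P n s).coeff k) t)
    (h : ℕ → ℝ → ℝ)
    (hh : ∀ n : ℕ, ∀ t : ℝ, 0 < t → h n t = ∫ x : ℝ, ((P n t).eval x) ^ 2 * w t x)
    (hhpos : ∀ n : ℕ, ∀ t : ℝ, 0 < t → 0 < h n t)
    (R : ℕ → ℝ → ℝ)
    (hR : ∀ n : ℕ, ∀ t : ℝ, 0 < t →
      R n t = 2 * t / h n t * ∫ y : ℝ, ((P n t).eval y) ^ 2 / y ^ 2 * w t y)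
    (D : ℕ → ℝ → ℝ)
    (hD : ∀ n : ℕ, ∀ t : ℝ, 0 < t → D n t = Matrix.det
      (Matrix.of fun i j : Fin n => ∫ x : ℝ, x ^ ((i : ℕ) + (j : ℕ)) * w t x))
    (σ : ℕ → ℝ → ℝ)
    (hσ : ∀ n : ℕ, ∀ t : ℝ, 0 < t → σ n t = -∑ j ∈ Finset.range n, R j t)
    (n : ℕ) (hn : 1 ≤ n) (t₀ : ℝ) (ht₀ : 0 < t₀) :
    ∃ d : ℝ, HasDerivAt (D n) d t₀ ∧ 2 * t₀ * d = σ n t₀ * D n t₀ := by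
  let p : ℕ → ℝ[X] := fun i => P i t₀
  let M : ℝ → Matrix (Fin n) (Fin n) ℝ := fun s =>
    Matrix.of fun i j => ∫ x : ℝ, (p i * p j).eval x * w s x
  have hDM : ∀ s, 0 < s → D n s = (M s).det := fun s hs => by
    rw [hD n s hs]
    exact det_moments_eq_det_integral_eval_mul n p (fun i => hmonic i t₀ ht₀)
      (fun i => hdeg i t₀ ht₀) hs
  have hMdiag : M t₀ = Matrix.diagonal fun i : Fin n => h i t₀ := by
    ext i j
    rcases eq_or_ne i j with rfl | hij
    · simp [M, p, hh _ t₀ ht₀, sq]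
    · rw [Matrix.diagonal_apply_ne _ hij]
      simpa [M, p] using horth i j (fun e => hij (Fin.ext e)) t₀ ht₀
  have hM' : ∀ i j, HasDerivAt (fun s => M s i j)
      (Matrix.of (fun i j : Fin n => -∫ x : ℝ, (p i * p j).eval x / x ^ 2 * w t₀ x) i j) t₀ :=
    fun i j => hasDerivAt_integral_eval_mul_w (p i * p j) ht₀
  refine ⟨_, (HasDerivAt.det_of_eq_diagonal hM' hMdiag).congr_of_eventuallyEq
    ((lt_mem_nhds ht₀).mono hDM), ?_⟩
  rw [hσ n t₀ ht₀, hDM t₀ ht₀, hMdiag, Matrix.det_diagonal, Finset.mul_sum, neg_mul,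
    Finset.sum_range, Finset.sum_mul, ← Finset.sum_neg_distrib]
  refine Finset.sum_congr rfl fun i _ => ?_
  have hi := (hhpos i t₀ ht₀).ne'
  rw [← Finset.mul_prod_erase _ _ (Finset.mem_univ i), hR i t₀ ht₀]
  simp only [Matrix.of_apply, eval_mul, p, ← sq]
  field_simp
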